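/- Let A be a unital alternative *-algebra over ℂ containing a nontrivial symmetric idempotent e satisfying conditions (♠) and (♣), let Φ : A → A be a map satisfying the *-Jordan n-derivation identity in the last two slots, and let φ = Φ − Ξ_{y,e₁} where y = e₁(Φ(e₁)e₂) + e₂(Φ(e₁)e₁). Then for i ≠ j in {1,2}, for all a_{ii}, b_{ii} ∈ A_{ii} and a_{ij}, b_{ij} ∈ A_{ij} and b_{ji} ∈ A_{ji} and b_{jj} ∈ A_{jj}: φ(a_{ii}b_{ii}) = φ(a_{ii})b_{ii} + a_{ii}φ(b_{ii}); φ(a_{ii}b_{ij}) = φ(a_{ii})b_{ij} + a_{ii}φ(b_{ij}); φ(a_{ij}b_{ji}) = φ(a_{ij})b_{ji} + a_{ij}φ(b_{ji}); φ(a_{ij}b_{jj}) = φ(a_{ij})b_{jj} + a_{ij}φ(b_{jj}); and φ(a_{ij}b_{ij}) = φ(a_{ij})b_{ij} + a_{ij}φ(b_{ij}). -/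

import Mathlib

/-- The Jordan `•`-product `a • b = ab + b a*`. -/
def starJordan {A : Type*} [NonAssocRing A] [StarRing A] (a b : A) : A :=
  a * b + b * star a

/-- Left-normed iterated Jordan `•`-product of a list (empty list ↦ 0, junk value). -/
def leftStarJordan {A : Type*} [NonAssocRing A] [StarRing A] : List A → A
  | [] => 0
  | x :: xs => xs.foldl starJordan x

/-- The family `a₁ = ⋯ = a_{n-2} = 1`, `a_{n-1} = x`, `a_n = y`. -/
def lastTwoFamily {A : Type*} [One A] (n : ℕ) (x y : A) : Fin n → A :=
  fun i => if (i : ℕ) = n - 2 then x else if (i : ℕ) = n - 1 then y else 1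

/-- `e₁ = e`, `e₂ = 1 - e`. -/
def peirceIdem {A : Type*} [NonAssocRing A] (e : A) : Fin 2 → A :=
  fun i => if i = 0 then e else 1 - e

/-- Membership in the Peirce component `A_{ij}`: `eᵢ x = x` and `x eⱼ = x`. -/
def inPeirce {A : Type*} [NonAssocRing A] (e : A) (i j : Fin 2) (x : A) : Prop :=
  peirceIdem e i * x = x ∧ x * peirceIdem e j = x

/-- The inner derivation `Ξ_{y,z}(a) = y(za) − z(ya) + y(az) − (ya)z + (az)y − (ay)z`. -/
def innerDer {A : Type*} [NonAssocRing A] (y z a : A) : A :=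
  y * (z * a) - z * (y * a) + y * (a * z) - (y * a) * z + (a * z) * y - (a * y) * z

section Alternative

variable {A : Type*} [NonAssocRing A]

theorem associator_swap_left (halt : ∀ a b : A, a * a * b = a * (a * b)) (x y z : A) :
    associator x y z = -associator y x z := by
  have h := halt (x + y) z
  simp only [add_mul, mul_add, halt] at h
  rw [associator, associator, ← sub_eq_zero, ← sub_eq_zero.mpr h]
  abel

theorem associator_swap_right (halt : ∀ a b : A, b * a * a = b * (a * a)) (x y z : A) :
    associator x y z = -associator x z y := by
  have h := halt (y + z) x
  simp only [add_mul, mul_add, halt] at h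
  rw [associator, associator, ← sub_eq_zero, ← sub_eq_zero.mpr h]
  abel

theorem innerDer_add (y z a b : A) : innerDer y z (a + b) = innerDer y z a + innerDer y z b := by
  simp only [innerDer, mul_add, add_mul]
  abel

theorem innerDer_eq_associator (halt₁ : ∀ a b : A, a * a * b = a * (a * b))
    (halt₂ : ∀ a b : A, b * a * a = b * (a * a)) (y z a : A) :
    innerDer y z a = (y * z - z * y) * a - a * (y * z - z * y) - 3 • associator y z a := by
  have h₁ := associator_swap_right halt₂ y a z
  have h₂ := associator_swap_left halt₁ a y z
  have h₄ := associator_swap_left halt₁ z y a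
  have h₃ := associator_swap_right halt₂ a z y
  clear halt₁ halt₂
  simp only [innerDer, associator, mul_sub, sub_mul] at *
  grind

/-- In an alternative ring every inner derivation `Ξ_{y,z}` satisfies the Leibniz rule. -/
theorem innerDer_mul (halt₁ : ∀ a b : A, a * a * b = a * (a * b))
    (halt₂ : ∀ a b : A, b * a * a = b * (a * a)) (y z a b : A) :
    innerDer y z (a * b) = innerDer y z a * b + a * innerDer y z b := by
  have alt₁ := associator_swap_left halt₁
  have alt₂ := associator_swap_right halt₂
  have k₁ := associator_cocycle a b y z
  have k₂ := associator_cocycle a b z y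
  have k₃ := associator_cocycle a y b z
  have k₄ := associator_cocycle z a b y
  have k₅ := associator_cocycle z a y b
  simp only [innerDer_eq_associator halt₁ halt₂]
  have hc : ∀ v : A, v * (a * b) - a * b * v - (v * a - a * v) * b - a * (v * b - b * v) =
      -(3 • associator v a b) := by
    intro v
    have h₁ := alt₁ a v b
    have h₂ := alt₂ a b v
    clear alt₁ alt₂ k₁ k₂ k₃ k₄ k₅ halt₁ halt₂
    simp only [associator, mul_sub, sub_mul] at *
    grind
  have hv : associator (y * z - z * y) a b = associator (y * z) a b - associator (z * y) a b := by
    simp only [associator, sub_mul]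
    abel
  have key : associator (y * z) a b - associator (z * y) a b + associator y z (a * b)
      - associator y z a * b - a * associator y z b = 0 := by
    clear hc hv halt₁ halt₂
    have cyc : ∀ x y z : A, associator x y z = associator y z x := fun x y z => by
      rw [alt₁, alt₂, neg_neg]
    simp only [alt₂ b z y, alt₁ y b z, ← cyc b y z, alt₂ a y b, cyc z a b, cyc z a y,
      mul_neg, neg_mul] at k₁ k₂ k₃ k₄ k₅ ⊢
    grind
  have h := hc (y * z - z * y)
  clear hc alt₁ alt₂ k₁ k₂ k₃ k₄ k₅ halt₁ halt₂
  rw [hv] at h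
  simp only [mul_sub, sub_mul, smul_mul_assoc, mul_smul_comm] at h ⊢
  grind

end Alternative

/-- `x` lies in the Peirce component of `e` with left weight `α` and right weight `β`. -/
structure PeirceWeight {A : Type*} [NonAssocRing A] (e : A) (α β : ℤ) (x : A) : Prop where
  left : e * x = α • x
  right : x * e = β • x

/-- A symmetric idempotent in an alternative `*`-ring such that both Peirce corners act
faithfully. -/
structure IsFaithfulIdem {A : Type*} [NonAssocRing A] [StarRing A] (e : A) : Prop where
  alt_left : ∀ a b : A, a * a * b = a * (a * b)
  alt_right : ∀ a b : A, b * a * a = b * (a * a)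
  star_eq : star e = e
  idem : e * e = e
  eq_zero : ∀ x : A, (∀ r : A, x * r * e = 0) → x = 0
  eq_zero_compl : ∀ x : A, (∀ r : A, x * r * (1 - e) = 0) → x = 0

namespace PeirceWeight

variable {A : Type*} [NonAssocRing A] {e : A} {α β γ δ : ℤ} {x y a b c d : A}

theorem add (hx : PeirceWeight e α β x) (hy : PeirceWeight e α β y) :
    PeirceWeight e α β (x + y) :=
  ⟨by rw [mul_add, hx.left, hy.left, smul_add], by rw [add_mul, hx.right, hy.right, smul_add]⟩

theorem neg (hx : PeirceWeight e α β x) : PeirceWeight e α β (-x) :=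
  ⟨by rw [mul_neg, hx.left, smul_neg], by rw [neg_mul, hx.right, smul_neg]⟩

theorem sub (hx : PeirceWeight e α β x) (hy : PeirceWeight e α β y) :
    PeirceWeight e α β (x - y) :=
  sub_eq_add_neg x y ▸ hx.add hy.neg

theorem zero : PeirceWeight e α β (0 : A) := ⟨by simp, by simp⟩

theorem nsmul (n : ℕ) (hx : PeirceWeight e α β x) : PeirceWeight e α β (n • x) :=
  ⟨by rw [mul_smul_comm, hx.left, smul_comm], by rw [smul_mul_assoc, hx.right, smul_comm]⟩

theorem compl (hx : PeirceWeight e α β x) : PeirceWeight (1 - e) (1 - α) (1 - β) x :=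
  ⟨by rw [sub_mul, one_mul, hx.left, sub_smul, one_smul],
    by rw [mul_sub, mul_one, hx.right, sub_smul, one_smul]⟩

theorem of_compl (hx : PeirceWeight (1 - e) (1 - α) (1 - β) x) : PeirceWeight e α β x := by
  simpa using hx.compl

theorem star [StarRing A] (he : IsFaithfulIdem e) (hx : PeirceWeight e α β x) :
    PeirceWeight e β α (star x) := by
  have h₁ := congrArg Star.star hx.left
  have h₂ := congrArg Star.star hx.right
  rw [star_mul, he.star_eq, star_zsmul] at h₁ h₂
  exact ⟨h₂, h₁⟩

theorem mul [StarRing A] (he : IsFaithfulIdem e) (hx : PeirceWeight e α β x)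
    (hy : PeirceWeight e γ δ y) : PeirceWeight e (α + β - γ) (δ - β + γ) (x * y) := by
  have h₁ := associator_swap_left he.alt_left e x y
  have h₂ := associator_swap_right he.alt_right x y e
  simp only [associator, hx.left, hx.right, hy.left, hy.right, smul_mul_assoc,
    mul_smul_comm] at h₁ h₂
  constructor
  · simp only [add_smul, sub_smul]
    grind
  · simp only [add_smul, sub_smul]
    grind

theorem eq_zero_of_two [StarRing A] [IsAddTorsionFree A] (he : IsFaithfulIdem e)
    (hx : PeirceWeight e 2 β x) : x = 0 := by
  have h := he.alt_left e x
  simp only [he.idem, hx.left, mul_smul_comm] at h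
  grind

theorem eq_zero_of_two' [StarRing A] [IsAddTorsionFree A] (he : IsFaithfulIdem e)
    (hx : PeirceWeight e α 2 x) : x = 0 := by
  have h := he.alt_right e x
  simp only [he.idem, hx.right, smul_mul_assoc] at h
  grind

theorem eq_zero_of_add [IsAddTorsionFree A] (ha : PeirceWeight e 1 1 a)
    (hb : PeirceWeight e 1 0 b) (hc : PeirceWeight e 0 1 c) (hd : PeirceWeight e 0 0 d)
    (h : a + b + c + d = 0) : a = 0 ∧ b = 0 ∧ c = 0 ∧ d = 0 := by
  have h₁ := congrArg (e * ·) h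
  have h₂ := congrArg (· * e) h
  simp only [mul_add, add_mul, ha.left, ha.right, hb.left, hb.right, hc.left, hc.right,
    hd.left, hd.right, one_smul, zero_smul, mul_zero, zero_mul, add_zero] at h₁ h₂
  have h₃ := congrArg (· * e) h₁
  simp only [add_mul, ha.right, hb.right, one_smul, zero_smul, zero_mul, add_zero] at h₃
  grind

end PeirceWeight

namespace IsFaithfulIdem

variable {A : Type*} [NonAssocRing A] [StarRing A] {e : A}

theorem compl (he : IsFaithfulIdem e) : IsFaithfulIdem (1 - e) where
  alt_left := he.alt_left
  alt_right := he.alt_right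
  star_eq := by rw [star_sub, star_one, he.star_eq]
  idem := by simp [sub_mul, mul_sub, he.idem]
  eq_zero := he.eq_zero_compl
  eq_zero_compl := by simpa using he.eq_zero

theorem weight_self (he : IsFaithfulIdem e) : PeirceWeight e 1 1 e :=
  ⟨by rw [he.idem, one_smul], by rw [he.idem, one_smul]⟩

theorem weight_compl (he : IsFaithfulIdem e) : PeirceWeight e 0 0 (1 - e) :=
  ⟨by simp [mul_sub, he.idem], by simp [sub_mul, he.idem]⟩

theorem exists_peirce (he : IsFaithfulIdem e) (x : A) :
    ∃ a b c d : A, PeirceWeight e 1 1 a ∧ PeirceWeight e 1 0 b ∧ PeirceWeight e 0 1 c ∧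
      PeirceWeight e 0 0 d ∧ x = a + b + c + d := by
  have hl : ∀ y, e * (e * y) = e * y := fun y => by rw [← he.alt_left, he.idem]
  have hr : ∀ y, y * e * e = y * e := fun y => by rw [he.alt_right, he.idem]
  have hm : ∀ y, e * y * e = e * (y * e) := fun y => by
    have h₁ := associator_swap_left he.alt_left e y e
    have h₂ := he.alt_right e y
    simp only [associator, hr, he.idem, sub_self, neg_zero] at h₁
    exact sub_eq_zero.1 h₁
  refine ⟨e * (x * e), e * x - e * (x * e), x * e - e * (x * e),
    x - e * x - x * e + e * (x * e), ⟨?_, ?_⟩, ⟨?_, ?_⟩, ⟨?_, ?_⟩, ⟨?_, ?_⟩, by abel⟩ <;>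
  simp only [mul_sub, mul_add, sub_mul, add_mul, hl, hr, hm, one_smul, zero_smul] <;> abel

/-- The corner `A₁₁` acts faithfully on `A₁₂`. -/
theorem eq_zero_of_mul [IsAddTorsionFree A] (he : IsFaithfulIdem e) {t : A}
    (ht : PeirceWeight e 1 1 t)
    (h : ∀ c, PeirceWeight e 1 0 c → t * c = 0) : t = 0 := by
  refine he.eq_zero_compl t fun r => ?_
  obtain ⟨p, q, r, s, hp, hq, hr, hs, rfl⟩ := he.exists_peirce r
  have h₁ := (ht.mul he hp).right
  have h₂ := h q hq
  have h₃ := (ht.mul he hr).eq_zero_of_two he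
  have h₄ := (ht.mul he hs).eq_zero_of_two he
  norm_num at h₁
  simp [mul_add, mul_sub, h₁, h₂, h₃, h₄]

end IsFaithfulIdem

section starJordan

variable {A : Type*} [NonAssocRing A] [StarRing A]

theorem starJordan_add (x y z : A) : starJordan x (y + z) = starJordan x y + starJordan x z := by
  simp only [starJordan, mul_add, add_mul]
  abel

theorem add_starJordan (x y z : A) : starJordan (x + y) z = starJordan x z + starJordan y z := by
  simp only [starJordan, star_add, mul_add, add_mul]
  abel

theorem starJordan_sub (x y z : A) : starJordan x (y - z) = starJordan x y - starJordan x z := by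
  simp only [starJordan, mul_sub, sub_mul]
  abel

theorem sub_starJordan (x y z : A) : starJordan (x - y) z = starJordan x z - starJordan y z := by
  simp only [starJordan, star_sub, mul_sub, sub_mul]
  abel

theorem starJordan_zero (x : A) : starJordan x 0 = 0 := by simp [starJordan]

theorem zero_starJordan (x : A) : starJordan 0 x = 0 := by simp [starJordan]

theorem one_starJordan (x : A) : starJordan 1 x = 2 • x := by simp [starJordan, two_smul]

theorem starJordan_one (x : A) : starJordan x 1 = x + star x := by simp [starJordan]

theorem nsmul_starJordan (n : ℕ) (x y : A) : starJordan (n • x) y = n • starJordan x y := by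
  simp only [starJordan, star_nsmul, mul_smul_comm, smul_mul_assoc, smul_add]

theorem PeirceWeight.starJordan_idem {e x : A} {α β : ℤ} (he : IsFaithfulIdem e)
    (hx : PeirceWeight e α β x) : starJordan e x = (α + β) • x := by
  rw [starJordan, he.star_eq, hx.left, hx.right, add_smul]

theorem PeirceWeight.starJordan_compl {e x : A} {α β : ℤ} (he : IsFaithfulIdem e)
    (hx : PeirceWeight e α β x) : starJordan (1 - e) x = (2 - α - β) • x := by
  rw [hx.compl.starJordan_idem he.compl]
  congr 1
  ring

end starJordan

section Kernel

variable {A : Type*} [NonAssocRing A] [StarRing A] [IsAddTorsionFree A] {e t : A}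

theorem PeirceWeight.of_starJordan_compl (he : IsFaithfulIdem e)
    (ht : starJordan (1 - e) t = 0) : PeirceWeight e 1 1 t := by
  obtain ⟨p, q, r, s, hp, hq, hr, hs, rfl⟩ := he.exists_peirce t
  simp only [starJordan_add, hp.starJordan_compl he, hq.starJordan_compl he,
    hr.starJordan_compl he, hs.starJordan_compl he] at ht
  obtain ⟨-, h₁, h₂, h₃⟩ := PeirceWeight.eq_zero_of_add (a := 0) (d := 2 • s) .zero hq hr
    (hs.nsmul 2) (by refine Eq.trans ?_ ht; norm_num [two_smul])
  have h₄ : s = 0 := by grind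
  simpa [h₁, h₂, h₄] using hp

theorem PeirceWeight.of_starJordan_idem (he : IsFaithfulIdem e)
    (ht : starJordan e t = 0) : PeirceWeight e 0 0 t := by
  have h : starJordan (1 - (1 - e)) t = 0 := by rwa [sub_sub_cancel]
  exact (PeirceWeight.of_starJordan_compl he.compl h).of_compl

/-- The kernel of `(e₁ - e₂) • ·` is the sum of the off-diagonal components. -/
theorem exists_offDiagonal (he : IsFaithfulIdem e) (ht : starJordan (e - (1 - e)) t = 0) :
    ∃ q r, PeirceWeight e 1 0 q ∧ PeirceWeight e 0 1 r ∧ t = q + r := by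
  obtain ⟨p, q, r, s, hp, hq, hr, hs, rfl⟩ := he.exists_peirce t
  simp only [sub_starJordan, starJordan_add, hp.starJordan_compl he, hq.starJordan_compl he,
    hr.starJordan_compl he, hs.starJordan_compl he, hp.starJordan_idem he, hq.starJordan_idem he,
    hr.starJordan_idem he, hs.starJordan_idem he] at ht
  obtain ⟨h₁, -, -, h₃⟩ := PeirceWeight.eq_zero_of_add (a := 2 • p) (b := 0) (c := 0)
    (d := -(2 • s)) (hp.nsmul 2) .zero .zero (hs.nsmul 2).neg
    (by refine Eq.trans ?_ ht; norm_num [two_smul])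
  have h₄ : s = 0 := by grind
  have h₅ : p = 0 := by grind
  exact ⟨q, r, hq, hr, by simp [h₄, h₅]⟩

theorem PeirceWeight.of_starJordan (he : IsFaithfulIdem e)
    (ht : starJordan (e - (1 - e)) t = 0) (ht' : starJordan t e = 0) : PeirceWeight e 1 0 t := by
  obtain ⟨q, r, hq, hr, rfl⟩ := exists_offDiagonal he ht
  have hr' := hr.star he
  have hq' := hq.star he
  simp only [starJordan, star_add, mul_add, add_mul, hq.right, hr.right, hr'.left, hq'.left,
    one_smul, zero_smul, zero_add] at ht'
  obtain ⟨-, -, h, -⟩ := PeirceWeight.eq_zero_of_add (a := 0) (d := 0) .zero hr' hr .zero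
    (by refine Eq.trans ?_ ht'; abel)
  simpa [h] using hq

theorem PeirceWeight.of_starJordan' (he : IsFaithfulIdem e)
    (ht : starJordan (e - (1 - e)) t = 0) (ht' : starJordan t (1 - e) = 0) :
    PeirceWeight e 0 1 t := by
  refine (PeirceWeight.of_starJordan he.compl ?_ ht').of_compl
  rw [sub_starJordan] at ht ⊢
  rw [sub_sub_cancel, ← neg_sub, ht, neg_zero]

end Kernel

/-- A map obeying `Φ (N (x • y)) = N (Φ x • y + x • Φ y) + (S • x) • y`. -/
def IsScaledStarJordanDer {A : Type*} [NonAssocRing A] [StarRing A] (N : ℕ) (S : A)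
    (Φ : A → A) : Prop :=
  ∀ x y, Φ (N • starJordan x y) =
    N • (starJordan (Φ x) y + starJordan x (Φ y)) + starJordan (starJordan S x) y

/-- The defect of additivity of `Φ`. -/
def addDefect {A : Type*} [NonAssocRing A] (Φ : A → A) (x y : A) : A := Φ (x + y) - Φ x - Φ y

section addDefect

theorem addDefect_eq_zero {A : Type*} [NonAssocRing A] {Φ : A → A} {x y : A} :
    addDefect Φ x y = 0 ↔ Φ (x + y) = Φ x + Φ y := by
  rw [addDefect, sub_sub, sub_eq_zero]

variable {A : Type*} [NonAssocRing A] [StarRing A] {e : A}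
  {N : ℕ} {S : A} {Φ : A → A} {x y a b c d : A}

namespace IsScaledStarJordanDer

theorem map_zero (hΦ : IsScaledStarJordanDer N S Φ) : Φ 0 = 0 := by
  simpa [starJordan] using hΦ 0 0

theorem addDefect_zero (hΦ : IsScaledStarJordanDer N S Φ) : addDefect Φ 0 y = 0 := by
  simp [addDefect, hΦ.map_zero]

theorem addDefect_zero' (hΦ : IsScaledStarJordanDer N S Φ) : addDefect Φ x 0 = 0 := by
  simp [addDefect, hΦ.map_zero]

theorem addDefect_right (hΦ : IsScaledStarJordanDer N S Φ) (x y y' : A) :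
    addDefect Φ (N • starJordan x y) (N • starJordan x y') =
      N • starJordan x (addDefect Φ y y') := by
  have h := hΦ x (y + y')
  rw [starJordan_add, smul_add] at h
  rw [addDefect, h, hΦ, hΦ, addDefect]
  simp only [starJordan_add, starJordan_sub, smul_add, smul_sub]
  abel

theorem addDefect_left (hΦ : IsScaledStarJordanDer N S Φ) (x x' y : A) :
    addDefect Φ (N • starJordan x y) (N • starJordan x' y) =
      N • starJordan (addDefect Φ x x') y := by
  have h := hΦ (x + x') y
  rw [add_starJordan, smul_add] at h
  rw [addDefect, h, hΦ, hΦ, addDefect]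
  simp only [starJordan_add, add_starJordan, sub_starJordan, smul_add, smul_sub]
  abel

end IsScaledStarJordanDer

theorem PeirceWeight.starJordan_sub_compl (he : IsFaithfulIdem e) {α β : ℤ}
    (hx : PeirceWeight e α β x) : starJordan (e - (1 - e)) x = (2 * (α + β - 1)) • x := by
  rw [sub_starJordan, hx.starJordan_idem he, hx.starJordan_compl he, ← sub_smul]
  congr 1
  ring

theorem PeirceWeight.starJordan_right_eq_zero (he : IsFaithfulIdem e)
    (hx : PeirceWeight e 1 0 x) : starJordan x e = 0 := by
  simp [starJordan, hx.right, (hx.star he).left]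

theorem PeirceWeight.starJordan_right_compl_eq_zero (he : IsFaithfulIdem e)
    (hx : PeirceWeight e 0 1 x) : starJordan x (1 - e) = 0 :=
  hx.compl.starJordan_right_eq_zero he.compl

variable [IsAddTorsionFree A]

namespace IsScaledStarJordanDer

theorem starJordan_addDefect (hΦ : IsScaledStarJordanDer N S Φ) (hN : N ≠ 0)
    (h : starJordan x a = 0 ∨ starJordan x b = 0) : starJordan x (addDefect Φ a b) = 0 := by
  have h' := hΦ.addDefect_right x a b
  rcases h with h | h <;> rw [h, smul_zero] at h'
  · rw [hΦ.addDefect_zero] at h'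
    exact (smul_eq_zero_iff_right hN).1 h'.symm
  · rw [hΦ.addDefect_zero'] at h'
    exact (smul_eq_zero_iff_right hN).1 h'.symm

theorem addDefect_starJordan (hΦ : IsScaledStarJordanDer N S Φ) (hN : N ≠ 0)
    (h : starJordan a y = 0 ∨ starJordan b y = 0) : starJordan (addDefect Φ a b) y = 0 := by
  have h' := hΦ.addDefect_left a b y
  rcases h with h | h <;> rw [h, smul_zero] at h'
  · rw [hΦ.addDefect_zero] at h'
    exact (smul_eq_zero_iff_right hN).1 h'.symm
  · rw [hΦ.addDefect_zero'] at h'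
    exact (smul_eq_zero_iff_right hN).1 h'.symm

variable (he : IsFaithfulIdem e) (hΦ : IsScaledStarJordanDer N S Φ) (hN : N ≠ 0)
include he hΦ hN

theorem addDefect_offDiagonal (hb : PeirceWeight e 1 0 b) (hc : PeirceWeight e 0 1 c) :
    addDefect Φ b c = 0 := by
  have h := hΦ.starJordan_addDefect hN (x := e - (1 - e)) (a := b) (b := c)
    (.inl (by rw [hb.starJordan_sub_compl he]; norm_num))
  have h₁ := PeirceWeight.of_starJordan he h
    (hΦ.addDefect_starJordan hN (.inl (hb.starJordan_right_eq_zero he)))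
  have h₂ := PeirceWeight.of_starJordan' he h
    (hΦ.addDefect_starJordan hN (.inr (hc.starJordan_right_compl_eq_zero he)))
  simpa [h₂.left] using h₁.left.symm

theorem addDefect_corner (ha : PeirceWeight e 1 1 a) (hb : PeirceWeight e 1 0 b)
    (hc : PeirceWeight e 0 1 c) : addDefect Φ a (b + c) = 0 := by
  have h₁ := PeirceWeight.of_starJordan_compl he
    (hΦ.starJordan_addDefect hN (x := 1 - e) (a := a) (b := b + c)
      (.inl (by rw [ha.starJordan_compl he]; norm_num)))
  have h₂ := hΦ.starJordan_addDefect hN (x := e - (1 - e)) (a := a) (b := b + c)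
    (.inr (by rw [starJordan_add, hb.starJordan_sub_compl he, hc.starJordan_sub_compl he]
              norm_num))
  rw [h₁.starJordan_sub_compl he] at h₂
  grind

theorem map_peirce (ha : PeirceWeight e 1 1 a) (hb : PeirceWeight e 1 0 b)
    (hc : PeirceWeight e 0 1 c) (hd : PeirceWeight e 0 0 d) :
    Φ (a + b + c + d) = Φ a + Φ b + Φ c + Φ d := by
  have h₁ := hΦ.addDefect_corner he hN ha hb hc
  have h₂ := hΦ.addDefect_corner he.compl hN hd.compl hc.compl hb.compl
  have h₃ := hΦ.addDefect_offDiagonal he hN hb hc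
  have h₄ := PeirceWeight.of_starJordan_idem he
    (hΦ.starJordan_addDefect hN (x := e) (a := a + (b + c)) (b := d)
      (.inr (by rw [hd.starJordan_idem he]; norm_num)))
  have h₅ := PeirceWeight.of_starJordan_compl he
    (hΦ.starJordan_addDefect hN (x := 1 - e) (a := a) (b := d + (c + b))
      (.inl (by rw [ha.starJordan_compl he]; norm_num)))
  have h₆ : addDefect Φ a (d + (c + b)) = addDefect Φ (a + (b + c)) d := by
    rw [addDefect_eq_zero] at h₁ h₂
    rw [addDefect, addDefect, h₁, h₂, add_comm c b,
      show a + (d + (b + c)) = a + (b + c) + d by abel]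
    abel
  have h₇ := h₅.left
  rw [h₆, h₄.left, zero_smul, one_smul] at h₇
  rw [eq_comm, addDefect_eq_zero] at h₇
  rw [addDefect_eq_zero] at h₁ h₃
  rw [add_assoc a b c, h₇, h₁, h₃]
  abel

theorem weight_addDefect (ha : PeirceWeight e 1 0 a) (b : A) :
    PeirceWeight e 1 0 (addDefect Φ a b) :=
  .of_starJordan he
    (hΦ.starJordan_addDefect hN (.inl (by rw [ha.starJordan_sub_compl he]; norm_num)))
    (hΦ.addDefect_starJordan hN (.inl (ha.starJordan_right_eq_zero he)))

theorem addDefect_upper (ha : PeirceWeight e 1 0 a) (hb : PeirceWeight e 1 0 b) :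
    addDefect Φ a b = 0 := by
  have hab : PeirceWeight e 0 1 (a * b) := ha.mul he hb
  have has := ha.star he
  have hba : PeirceWeight e 1 1 (b * star a) := hb.mul he has
  have h₁ : Φ (e + a) = Φ e + Φ a := by
    simpa [hΦ.map_zero] using hΦ.map_peirce he hN he.weight_self ha .zero .zero
  have h₂ : Φ (b + (1 - e)) = Φ b + Φ (1 - e) := by
    simpa [hΦ.map_zero] using hΦ.map_peirce he hN .zero hb .zero he.weight_compl
  have hx : ∀ y, Φ (N • starJordan (e + a) y) =
      Φ (N • starJordan e y) + Φ (N • starJordan a y) := fun y => by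
    have h := hΦ.addDefect_left e a y
    rw [addDefect_eq_zero.2 h₁, zero_starJordan, smul_zero, addDefect_eq_zero, ← smul_add,
      ← add_starJordan] at h
    exact h
  have hy : ∀ x, Φ (N • starJordan x (b + (1 - e))) =
      Φ (N • starJordan x b) + Φ (N • starJordan x (1 - e)) := fun x => by
    have h := hΦ.addDefect_right x b (1 - e)
    rw [addDefect_eq_zero.2 h₂, starJordan_zero, smul_zero, addDefect_eq_zero, ← smul_add,
      ← starJordan_add] at h
    exact h
  have heb : starJordan e b = b := by rw [hb.starJordan_idem he]; norm_num
  have hee : starJordan e (1 - e) = 0 := by rw [he.weight_compl.starJordan_idem he]; norm_num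
  have hae : starJordan a (1 - e) = a + star a := by
    simp [starJordan, mul_sub, sub_mul, ha.right, has.left]
  have h := hx (b + (1 - e))
  rw [hy e, hy a, starJordan_add, add_starJordan, add_starJordan, heb, hee, hae] at h
  simp only [starJordan, smul_zero, hΦ.map_zero] at h
  have h₃ := hΦ.map_peirce he hN (hba.nsmul N) ((ha.nsmul N).add (hb.nsmul N))
    ((has.nsmul N).add (hab.nsmul N)) .zero
  have h₄ := hΦ.map_peirce he hN .zero (ha.nsmul N) (has.nsmul N) .zero
  have h₅ := hΦ.map_peirce he hN (hba.nsmul N) .zero (hab.nsmul N) .zero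
  rw [show N • (b * star a) + (N • a + N • b) + (N • star a + N • (a * b)) + 0 =
    N • (b + (a * b + b * star a) + (0 + (a + star a))) by simp only [smul_add, smul_zero]; abel, h,
    smul_add, smul_add] at h₃
  simp only [zero_add, add_zero, hΦ.map_zero] at h₃ h₄ h₅
  rw [add_comm (N • (a * b)), h₅, h₄] at h₃
  have h₆ := hΦ.weight_addDefect he hN (ha.nsmul N) (N • b)
  have h₇ := PeirceWeight.of_compl (e := e) (α := 0) (β := 1)
    (hΦ.weight_addDefect he.compl hN (has.nsmul N).compl (N • (a * b)))
  have h₈ := PeirceWeight.eq_zero_of_add .zero h₆ h₇ .zero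
    (by rw [addDefect, addDefect, zero_add, add_zero]; grind)
  have h₉ := hΦ.addDefect_right e a b
  have hea : starJordan e a = a := by rw [ha.starJordan_idem he]; norm_num
  rw [hea, heb, h₈.2.1, (hΦ.weight_addDefect he hN ha b).starJordan_idem he, eq_comm,
    smul_eq_zero_iff_right hN] at h₉
  simpa using h₉

theorem addDefect_diagonal (ha : PeirceWeight e 1 1 a) (hb : PeirceWeight e 1 1 b) :
    addDefect Φ a b = 0 := by
  have ht := PeirceWeight.of_starJordan_compl he
    (hΦ.starJordan_addDefect hN (x := 1 - e) (a := a) (b := b)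
      (.inl (by rw [ha.starJordan_compl he]; norm_num)))
  have key : ∀ {t c : A}, PeirceWeight e 1 1 t → PeirceWeight e 1 0 c →
      starJordan t c = t * c := fun {t c} ht hc => by
    have h : c * star t = 0 := by
      have h := (hc.mul he (ht.star he)).eq_zero_of_two' he
      exact h
    rw [starJordan, h, add_zero]
  refine he.eq_zero_of_mul ht fun c hc => ?_
  have h := hΦ.addDefect_left a b c
  have hac : PeirceWeight e 1 0 (a * c) := ha.mul he hc
  have hbc : PeirceWeight e 1 0 (b * c) := hb.mul he hc
  rw [key ha hc, key hb hc, key ht hc, hΦ.addDefect_upper he hN (hac.nsmul N) (hbc.nsmul N),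
    eq_comm, smul_eq_zero_iff_right hN] at h
  exact h

theorem map_add (x y : A) : Φ (x + y) = Φ x + Φ y := by
  obtain ⟨a, b, c, d, ha, hb, hc, hd, rfl⟩ := he.exists_peirce x
  obtain ⟨a', b', c', d', ha', hb', hc', hd', rfl⟩ := he.exists_peirce y
  have h₁ := addDefect_eq_zero.1 (hΦ.addDefect_diagonal he hN ha ha')
  have h₂ := addDefect_eq_zero.1 (hΦ.addDefect_upper he hN hb hb')
  have h₃ := addDefect_eq_zero.1 (hΦ.addDefect_upper he.compl hN hc.compl hc'.compl)
  have h₄ := addDefect_eq_zero.1 (hΦ.addDefect_diagonal he.compl hN hd.compl hd'.compl)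
  rw [show a + b + c + d + (a' + b' + c' + d') = (a + a') + (b + b') + (c + c') + (d + d') by abel,
    hΦ.map_peirce he hN (ha.add ha') (hb.add hb') (hc.add hc') (hd.add hd'),
    hΦ.map_peirce he hN ha hb hc hd, hΦ.map_peirce he hN ha' hb' hc' hd', h₁, h₂, h₃, h₄]
  abel

end IsScaledStarJordanDer

end addDefect

theorem star_innerDer {A : Type*} [NonAssocRing A] [StarRing A]
    (halt₁ : ∀ a b : A, a * a * b = a * (a * b)) (halt₂ : ∀ a b : A, b * a * a = b * (a * a))
    {y z : A} (hy : star y = y) (hz : star z = z) (a : A) :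
    star (innerDer y z a) = innerDer y z (star a) := by
  have h₁ := associator_swap_left halt₁ y (star a) z
  have h₂ := associator_swap_right halt₂ (star a) y z
  have h₃ := associator_swap_left halt₁ (star a) z y
  clear halt₁ halt₂
  simp only [innerDer, star_add, star_sub, star_mul, hy, hz, associator] at *
  grind

theorem innerDer_starJordan {A : Type*} [NonAssocRing A] [StarRing A]
    (halt₁ : ∀ a b : A, a * a * b = a * (a * b)) (halt₂ : ∀ a b : A, b * a * a = b * (a * a))
    {y z : A} (hy : star y = y) (hz : star z = z) (a b : A) :
    innerDer y z (starJordan a b) =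
      starJordan (innerDer y z a) b + starJordan a (innerDer y z b) := by
  simp only [starJordan, innerDer_add, innerDer_mul halt₁ halt₂, star_innerDer halt₁ halt₂ hy hz]
  abel

theorem PeirceWeight.mul_mul_corner {A : Type*} [NonAssocRing A] [StarRing A] [IsAddTorsionFree A]
    {e a b c : A}
    (he : IsFaithfulIdem e) (ha : PeirceWeight e 1 1 a) (hb : PeirceWeight e 1 1 b)
    (hc : PeirceWeight e 1 0 c) : a * b * c = a * (b * c) := by
  have h₁ := associator_swap_right he.alt_right a b c
  have h₂ := associator_swap_left he.alt_left a c b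
  have h₃ := associator_cocycle c e a b
  have hca : c * a = 0 := (hc.mul he ha).eq_zero_of_two' he
  have hcb : c * (a * b) = 0 := (hc.mul he (ha.mul he hb)).eq_zero_of_two' he
  have hab : PeirceWeight e 1 1 (a * b) := ha.mul he hb
  simp only [associator, ha.left, hc.right, hab.left, hca, hcb, zero_smul, one_smul,
    zero_mul, mul_zero, sub_self, add_zero] at *
  grind

/-- Additive `*`-Jordan derivations. -/
structure IsStarJordanDer {A : Type*} [NonAssocRing A] [StarRing A] (φ : A → A) : Prop where
  map_add : ∀ x y, φ (x + y) = φ x + φ y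
  map_starJordan : ∀ x y, φ (starJordan x y) = starJordan (φ x) y + starJordan x (φ y)

namespace IsStarJordanDer

variable {A : Type*} [NonAssocRing A] [StarRing A] {e : A} {φ : A → A}

theorem map_zero (hφ : IsStarJordanDer φ) : φ 0 = 0 := by simpa using hφ.map_add 0 0

theorem map_sub (hφ : IsStarJordanDer φ) (x y : A) : φ (x - y) = φ x - φ y :=
  _root_.map_sub (AddMonoidHom.mk' φ hφ.map_add) x y

theorem sub_innerDer (hφ : IsStarJordanDer φ)
    (halt₁ : ∀ a b : A, a * a * b = a * (a * b)) (halt₂ : ∀ a b : A, b * a * a = b * (a * a))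
    {y z : A} (hy : star y = y) (hz : star z = z) :
    IsStarJordanDer fun a => φ a - innerDer y z a where
  map_add a b := by
    rw [hφ.map_add, innerDer_add]
    abel
  map_starJordan a b := by
    rw [hφ.map_starJordan, innerDer_starJordan halt₁ halt₂ hy hz, sub_starJordan, starJordan_sub]
    abel

theorem map_one (hφ : IsStarJordanDer φ) :
    star (φ 1) = -φ 1 ∧ ∀ y, starJordan (φ 1) y = 0 := by
  have h : ∀ y, starJordan (φ 1) y = 0 := fun y => by
    have h := hφ.map_starJordan 1 y
    rw [one_starJordan, one_starJordan, two_smul, two_smul, hφ.map_add] at h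
    grind
  refine ⟨?_, h⟩
  have h' := h 1
  rw [starJordan_one] at h'
  exact (neg_eq_of_add_eq_zero_right h').symm

variable [IsAddTorsionFree A]

theorem idem_eq_zero (hφ : IsStarJordanDer φ) (he : IsFaithfulIdem e)
    (hw : PeirceWeight e 1 1 (φ e)) (hs : star (φ e) = -φ e) : φ e = 0 := by
  refine he.eq_zero_of_mul hw fun c hc => ?_
  have h := hφ.map_starJordan e c
  have h₁ : c * φ e = 0 := (hc.mul he hw).eq_zero_of_two' he
  obtain ⟨p, q, r, s, hp, hq, hr, hs', h₂⟩ := he.exists_peirce (φ c)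
  have ht : PeirceWeight e 1 0 (φ e * c) := hw.mul he hc
  rw [hc.starJordan_idem he, starJordan, hs, mul_neg, h₁, h₂] at h
  simp only [starJordan_add, hp.starJordan_idem he, hq.starJordan_idem he,
    hr.starJordan_idem he, hs'.starJordan_idem he] at h
  norm_num [h₂, two_smul] at h
  exact (PeirceWeight.eq_zero_of_add hp ht .zero hs'.neg (by grind)).2.1

/-- The diagonal and adjoint relations satisfied by the Peirce components of `Φ e`. -/
theorem peirce_idem (hφ : IsStarJordanDer φ) (he : IsFaithfulIdem e) :
    ∃ p q r, PeirceWeight e 1 1 p ∧ PeirceWeight e 1 0 q ∧ PeirceWeight e 0 1 r ∧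
      φ e = p + q + r ∧ star p = -p ∧ star r = q := by
  obtain ⟨p, q, r, s, hp, hq, hr, hs, h⟩ := he.exists_peirce (φ e)
  have h₁ := hφ.map_starJordan e e
  have hp' := hp.star he
  have hq' := hq.star he
  have hr' := hr.star he
  have hs' := hs.star he
  rw [he.weight_self.starJordan_idem he, show ((1 : ℤ) + 1) • e = e + e by norm_num [two_smul],
    hφ.map_add, h] at h₁
  simp only [starJordan, he.star_eq, star_add, mul_add, add_mul, hp.left, hq.left, hr.left,
    hs.left, hp.right, hq.right, hr.right, hs.right, hp'.left, hq'.left, hr'.left, hs'.left,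
    one_smul, zero_smul, add_zero] at h₁
  obtain ⟨h₂, h₃, -, h₅⟩ := PeirceWeight.eq_zero_of_add (hp.add hp') (hr'.sub hq) .zero
    ((hs.add hs).neg) (by grind)
  have h₆ : s = 0 := by grind
  exact ⟨p, q, r, hp, hq, hr, by rw [h, h₆, add_zero], (neg_eq_of_add_eq_zero_right h₂).symm,
    sub_eq_zero.1 h₃⟩

variable {a b : A}

theorem weight_corner (hφ : IsStarJordanDer φ) (he : IsFaithfulIdem e) (h₂ : φ (1 - e) = 0)
    (ha : PeirceWeight e 1 1 a) : PeirceWeight e 1 1 (φ a) := by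
  refine .of_starJordan_compl he ?_
  have h := hφ.map_starJordan (1 - e) a
  rw [ha.starJordan_compl he, h₂, zero_starJordan, zero_add] at h
  rw [← h]
  simpa using hφ.map_zero

theorem weight_upper (hφ : IsStarJordanDer φ) (he : IsFaithfulIdem e) (h₁ : φ e = 0)
    (h₂ : φ (1 - e) = 0) (ha : PeirceWeight e 1 0 a) : PeirceWeight e 1 0 (φ a) := by
  refine .of_starJordan he ?_ ?_
  · have h := hφ.map_starJordan (e - (1 - e)) a
    rw [ha.starJordan_sub_compl he, hφ.map_sub, h₁, h₂, sub_zero, zero_starJordan, zero_add] at h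
    rw [← h]
    simpa using hφ.map_zero
  · have h := hφ.map_starJordan a e
    rw [ha.starJordan_right_eq_zero he, hφ.map_zero, h₁, starJordan_zero, add_zero] at h
    exact h.symm

theorem weight_lower (hφ : IsStarJordanDer φ) (he : IsFaithfulIdem e) (h₁ : φ e = 0)
    (h₂ : φ (1 - e) = 0) (ha : PeirceWeight e 0 1 a) : PeirceWeight e 0 1 (φ a) :=
  .of_compl (hφ.weight_upper he.compl h₂ (by rwa [sub_sub_cancel]) ha.compl)

theorem weight_corner_compl (hφ : IsStarJordanDer φ) (he : IsFaithfulIdem e) (h₁ : φ e = 0)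
    (ha : PeirceWeight e 0 0 a) : PeirceWeight e 0 0 (φ a) :=
  .of_compl (hφ.weight_corner he.compl (by rwa [sub_sub_cancel]) ha.compl)

theorem leibniz_corner_upper (hφ : IsStarJordanDer φ) (he : IsFaithfulIdem e) (h₁ : φ e = 0)
    (h₂ : φ (1 - e) = 0) (ha : PeirceWeight e 1 1 a) (hb : PeirceWeight e 1 0 b) :
    φ (a * b) = φ a * b + a * φ b := by
  have key : ∀ {a b : A}, PeirceWeight e 1 1 a → PeirceWeight e 1 0 b →
      starJordan a b = a * b := fun {a b} ha hb => by
    have h : b * star a = 0 := (hb.mul he (ha.star he)).eq_zero_of_two' he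
    rw [starJordan, h, add_zero]
  have h := hφ.map_starJordan a b
  rwa [key ha hb, key (hφ.weight_corner he h₂ ha) hb,
    key ha (hφ.weight_upper he h₁ h₂ hb)] at h

theorem leibniz_upper_lower (hφ : IsStarJordanDer φ) (he : IsFaithfulIdem e) (h₁ : φ e = 0)
    (h₂ : φ (1 - e) = 0) (ha : PeirceWeight e 1 0 a) (hb : PeirceWeight e 0 1 b) :
    φ (a * b) = φ a * b + a * φ b := by
  have h := hφ.map_starJordan a b
  have ha' := hφ.weight_upper he h₁ h₂ ha
  have hb' := hφ.weight_lower he h₁ h₂ hb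
  have k₁ : PeirceWeight e 1 1 (a * b) := ha.mul he hb
  have k₂ : PeirceWeight e 1 1 (φ a * b) := ha'.mul he hb
  have k₃ : PeirceWeight e 1 1 (a * φ b) := ha.mul he hb'
  have l₁ : PeirceWeight e 1 0 (b * star a) := hb.mul he (ha.star he)
  have l₂ : PeirceWeight e 1 0 (b * star (φ a)) := hb.mul he (ha'.star he)
  have l₃ : PeirceWeight e 1 0 (φ b * star a) := hb'.mul he (ha.star he)
  have k := hφ.weight_corner he h₂ k₁
  have l := hφ.weight_upper he h₁ h₂ l₁
  simp only [starJordan, hφ.map_add] at h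
  have := (PeirceWeight.eq_zero_of_add ((k.sub k₂).sub k₃) ((l.sub l₂).sub l₃) .zero .zero
    (by grind)).1
  grind

theorem leibniz_upper_corner (hφ : IsStarJordanDer φ) (he : IsFaithfulIdem e) (h₁ : φ e = 0)
    (h₂ : φ (1 - e) = 0) (ha : PeirceWeight e 1 0 a) (hb : PeirceWeight e 0 0 b) :
    φ (a * b) = φ a * b + a * φ b := by
  have h := hφ.map_starJordan a b
  have ha' := hφ.weight_upper he h₁ h₂ ha
  have hb' := hφ.weight_corner_compl he h₁ hb
  have k₁ : PeirceWeight e 1 0 (a * b) := ha.mul he hb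
  have k₂ : PeirceWeight e 1 0 (φ a * b) := ha'.mul he hb
  have k₃ : PeirceWeight e 1 0 (a * φ b) := ha.mul he hb'
  have l₁ : PeirceWeight e 0 1 (b * star a) := hb.mul he (ha.star he)
  have l₂ : PeirceWeight e 0 1 (b * star (φ a)) := hb.mul he (ha'.star he)
  have l₃ : PeirceWeight e 0 1 (φ b * star a) := hb'.mul he (ha.star he)
  have k := hφ.weight_upper he h₁ h₂ k₁
  have l := hφ.weight_lower he h₁ h₂ l₁
  simp only [starJordan, hφ.map_add] at h
  have := (PeirceWeight.eq_zero_of_add .zero ((k.sub k₂).sub k₃) ((l.sub l₂).sub l₃) .zero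
    (by grind)).2.1
  grind

theorem leibniz_upper_upper (hφ : IsStarJordanDer φ) (he : IsFaithfulIdem e) (h₁ : φ e = 0)
    (h₂ : φ (1 - e) = 0) (ha : PeirceWeight e 1 0 a) (hb : PeirceWeight e 1 0 b) :
    φ (a * b) = φ a * b + a * φ b := by
  have h := hφ.map_starJordan a b
  have ha' := hφ.weight_upper he h₁ h₂ ha
  have hb' := hφ.weight_upper he h₁ h₂ hb
  have k₁ : PeirceWeight e 0 1 (a * b) := ha.mul he hb
  have k₂ : PeirceWeight e 0 1 (φ a * b) := ha'.mul he hb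
  have k₃ : PeirceWeight e 0 1 (a * φ b) := ha.mul he hb'
  have l₁ : PeirceWeight e 1 1 (b * star a) := hb.mul he (ha.star he)
  have l₂ : PeirceWeight e 1 1 (b * star (φ a)) := hb.mul he (ha'.star he)
  have l₃ : PeirceWeight e 1 1 (φ b * star a) := hb'.mul he (ha.star he)
  have k := hφ.weight_lower he h₁ h₂ k₁
  have l := hφ.weight_corner he h₂ l₁
  simp only [starJordan, hφ.map_add] at h
  have := (PeirceWeight.eq_zero_of_add ((l.sub l₂).sub l₃) .zero ((k.sub k₂).sub k₃) .zero
    (by grind)).2.2.1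
  grind

theorem leibniz_corner (hφ : IsStarJordanDer φ) (he : IsFaithfulIdem e) (h₁ : φ e = 0)
    (h₂ : φ (1 - e) = 0) (ha : PeirceWeight e 1 1 a) (hb : PeirceWeight e 1 1 b) :
    φ (a * b) = φ a * b + a * φ b := by
  have ha' := hφ.weight_corner he h₂ ha
  have hb' := hφ.weight_corner he h₂ hb
  have k₁ : PeirceWeight e 1 1 (a * b) := ha.mul he hb
  have k₂ : PeirceWeight e 1 1 (φ a * b) := ha'.mul he hb
  have k₃ : PeirceWeight e 1 1 (a * φ b) := ha.mul he hb'
  have k := hφ.weight_corner he h₂ k₁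
  rw [← sub_eq_zero, ← sub_sub]
  refine he.eq_zero_of_mul ((k.sub k₂).sub k₃) fun c hc => ?_
  have hbc : PeirceWeight e 1 0 (b * c) := hb.mul he hc
  have hc' := hφ.weight_upper he h₁ h₂ hc
  have h := hφ.leibniz_corner_upper he h₁ h₂ k₁ hc
  rw [ha.mul_mul_corner he hb hc, hφ.leibniz_corner_upper he h₁ h₂ ha hbc,
    hφ.leibniz_corner_upper he h₁ h₂ hb hc, ha.mul_mul_corner he hb hc', mul_add] at h
  rw [sub_mul, sub_mul, ha'.mul_mul_corner he hb hc, ha.mul_mul_corner he hb' hc]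
  grind

end IsStarJordanDer

theorem IsScaledStarJordanDer.isStarJordanDer {A : Type*} [NonAssocRing A] [StarRing A]
    [IsAddTorsionFree A] {e : A} (he : IsFaithfulIdem e) {N α β : ℕ} (hN : N ≠ 0) {Φ : A → A}
    (hΦ : IsScaledStarJordanDer N (α • Φ 1 + β • star (Φ 1)) Φ) : IsStarJordanDer Φ := by
  have hadd := hΦ.map_add he hN
  have hsmul : ∀ (n : ℕ) x, Φ (n • x) = n • Φ x :=
    fun n x => map_nsmul (AddMonoidHom.mk' Φ hadd) n x
  have hskew : Φ 1 + star (Φ 1) = 0 := by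
    have h := hΦ 1 1
    rw [hsmul] at h
    simp only [one_starJordan, starJordan_one, star_one, star_add, star_nsmul, star_star, hadd,
      smul_add] at h
    refine (smul_eq_zero_iff_right (r := N + 2 * (α + β)) (by omega)).1 ?_
    simp only [add_smul, mul_smul, two_smul, smul_add] at h ⊢
    grind
  have hstar : star (Φ 1) = -Φ 1 := (neg_eq_of_add_eq_zero_right hskew).symm
  have hcomm : ∀ y, starJordan (Φ 1) y = 0 := fun y => by
    have h := hΦ 1 y
    rw [hsmul, starJordan_one, star_add, star_nsmul, star_nsmul, star_star, hstar,
      show α • Φ 1 + β • -Φ 1 + (α • -Φ 1 + β • Φ 1) = 0 by simp only [smul_neg]; abel,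
      zero_starJordan, add_zero, one_starJordan, one_starJordan, hsmul, smul_add,
      right_eq_add] at h
    exact (smul_eq_zero_iff_right hN).1 h
  refine ⟨hadd, fun x y => ?_⟩
  have h := hΦ x y
  have h₀ : starJordan (-Φ 1) x = 0 := by
    rw [← zero_sub, sub_starJordan, hcomm, zero_starJordan, sub_zero]
  rw [hsmul, hstar, add_starJordan, nsmul_starJordan, nsmul_starJordan, hcomm, h₀, smul_zero,
    smul_zero, add_zero, zero_starJordan, add_zero] at h
  exact smul_right_injective A hN h

theorem update_comp_castSucc {A : Type*} {m : ℕ} (f : Fin (m + 1) → A) (i : Fin m) (c : A) :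
    (fun j : Fin m => Function.update f i.castSucc c j.castSucc) =
      Function.update (fun j : Fin m => f j.castSucc) i c := by
  ext j
  simp [Function.update_apply]

theorem update_last_comp_castSucc {A : Type*} {m : ℕ} (f : Fin (m + 1) → A) (c : A) :
    (fun j : Fin m => Function.update f (Fin.last m) c j.castSucc) = fun j => f j.castSucc := by
  ext j
  simp [Fin.ext_iff, j.2.ne]

theorem exists_sum_eq_nsmul_add_nsmul {A : Type*} [AddCommMonoid A] {ι : Type*}
    (s : Finset ι) (f : ι → A) (c d : A) (h : ∀ i, ∃ α β : ℕ, f i = α • c + β • d) :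
    ∃ α β : ℕ, ∑ i ∈ s, f i = α • c + β • d := by
  choose α β h using h
  exact ⟨∑ i ∈ s, α i, ∑ i ∈ s, β i, by
    simp only [h, Finset.sum_add_distrib, Finset.sum_smul]⟩

theorem lastTwoFamily_last {A : Type*} [One A] (m : ℕ) (x y : A) :
    lastTwoFamily (m + 2) x y (Fin.last (m + 1)) = y := by
  simp [lastTwoFamily]

theorem lastTwoFamily_castSucc_last {A : Type*} [One A] (m : ℕ) (x y : A) :
    lastTwoFamily (m + 2) x y (Fin.last m).castSucc = x := by
  simp [lastTwoFamily]

theorem lastTwoFamily_castSucc_castSucc {A : Type*} [One A] (m : ℕ) (x y : A) (i : Fin m) :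
    lastTwoFamily (m + 2) x y i.castSucc.castSucc = 1 := by
  simp [lastTwoFamily, i.2.ne, (i.2.trans m.lt_succ_self).ne]

section LeftStarJordan

variable {A : Type*} [NonAssocRing A] [StarRing A]

theorem leftStarJordan_concat {L : List A} (hL : L ≠ []) (x : A) :
    leftStarJordan (L ++ [x]) = starJordan (leftStarJordan L) x := by
  cases L with
  | nil => exact absurd rfl hL
  | cons a L => simp [leftStarJordan]

theorem leftStarJordan_ofFn_succ {m : ℕ} (f : Fin (m + 2) → A) :
    leftStarJordan (List.ofFn f) =
      starJordan (leftStarJordan (List.ofFn fun i : Fin (m + 1) => f i.castSucc))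
        (f (Fin.last (m + 1))) := by
  rw [List.ofFn_succ', List.concat_eq_append, leftStarJordan_concat]
  simp [List.ofFn_succ]

theorem leftStarJordan_ofFn_one (k : ℕ) :
    leftStarJordan (List.ofFn fun _ : Fin (k + 1) => (1 : A)) = 2 ^ k • (1 : A) := by
  induction k with
  | zero => simp [leftStarJordan]
  | succ k ih =>
    rw [leftStarJordan_ofFn_succ, ih, nsmul_starJordan, one_starJordan]
    simp [pow_succ, mul_smul]

theorem exists_leftStarJordan_update_one (k : ℕ) (i : Fin (k + 1)) (c : A) :
    ∃ α β : ℕ, leftStarJordan (List.ofFn (Function.update (fun _ => (1 : A)) i c)) =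
      α • c + β • star c := by
  induction k with
  | zero =>
    obtain rfl : i = 0 := Fin.fin_one_eq_zero i
    exact ⟨1, 0, by simp [leftStarJordan]⟩
  | succ k ih =>
    rw [leftStarJordan_ofFn_succ]
    induction i using Fin.lastCases with
    | last =>
      rw [update_last_comp_castSucc, leftStarJordan_ofFn_one, nsmul_starJordan,
        Function.update_self, one_starJordan]
      exact ⟨2 ^ k * 2, 0, by simp [mul_smul]⟩
    | cast i =>
      obtain ⟨α, β, h⟩ := ih i
      rw [update_comp_castSucc, h, Function.update_of_ne (Fin.castSucc_lt_last i).ne',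
        starJordan_one]
      refine ⟨α + β, α + β, ?_⟩
      simp only [star_add, star_nsmul, star_star, add_smul]
      abel

theorem starJordan_sum {ι : Type*} (s : Finset ι) (f : ι → A) (y : A) :
    starJordan (∑ i ∈ s, f i) y = ∑ i ∈ s, starJordan (f i) y :=
  map_sum (AddMonoidHom.mk' (starJordan · y) fun a b => add_starJordan a b y) f s

theorem exists_isScaledStarJordanDer {n : ℕ} (hn : 2 ≤ n) {Φ : A → A}
    (hΦ : ∀ x y : A,
      Φ (leftStarJordan (List.ofFn (lastTwoFamily n x y))) =
        ∑ k : Fin n, leftStarJordan (List.ofFn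
          (Function.update (lastTwoFamily n x y) k (Φ (lastTwoFamily n x y k))))) :
    ∃ N α β : ℕ, N ≠ 0 ∧ IsScaledStarJordanDer N (α • Φ 1 + β • star (Φ 1)) Φ := by
  obtain ⟨m, rfl⟩ := Nat.exists_eq_add_of_le' hn
  cases m with
  | zero =>
    refine ⟨1, 0, 0, one_ne_zero, fun x y => ?_⟩
    have h := hΦ x y
    have h₀ : lastTwoFamily 2 x y 0 = x := lastTwoFamily_castSucc_last 0 x y
    have h₁ : lastTwoFamily 2 x y 1 = y := lastTwoFamily_last 0 x y
    simpa [leftStarJordan, zero_starJordan, h₀, h₁] using h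
  | succ k =>
    obtain ⟨α, β, hS⟩ := exists_sum_eq_nsmul_add_nsmul Finset.univ
      (fun i : Fin (k + 1) => leftStarJordan
        (List.ofFn (Function.update (fun _ => (1 : A)) i (Φ 1)))) (Φ 1) (star (Φ 1))
      fun i => exists_leftStarJordan_update_one k i (Φ 1)
    refine ⟨2 ^ k * 2, α, β, by positivity, fun x y => ?_⟩
    have h := hΦ x y
    rw [Fin.sum_univ_castSucc, Fin.sum_univ_castSucc] at h
    simp only [leftStarJordan_ofFn_succ, update_comp_castSucc, update_last_comp_castSucc,
      lastTwoFamily_last, lastTwoFamily_castSucc_last, lastTwoFamily_castSucc_castSucc,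
      Function.update_self, leftStarJordan_ofFn_one, nsmul_starJordan, one_starJordan,
      Function.update_of_ne (Fin.castSucc_lt_last _).ne'] at h
    rw [← starJordan_sum, ← starJordan_sum, hS] at h
    simp only [mul_smul, smul_add]
    rw [h]
    abel

end LeftStarJordan

theorem IsStarJordanDer.map_compl_eq_zero {A : Type*} [NonAssocRing A] [StarRing A]
    [IsAddTorsionFree A] {e : A} {φ : A → A} (hφ : IsStarJordanDer φ) (he : IsFaithfulIdem e)
    (h₁ : φ e = 0) : φ (1 - e) = 0 := by
  have hw : PeirceWeight e 0 0 (φ (1 - e)) := by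
    refine .of_starJordan_idem he ?_
    have h := hφ.map_starJordan e (1 - e)
    have h₀ : starJordan e (1 - e) = 0 := by simp [starJordan, mul_sub, sub_mul, he.star_eq, he.idem]
    rwa [h₀, hφ.map_zero, h₁, zero_starJordan, zero_add, eq_comm] at h
  refine hφ.idem_eq_zero he.compl hw.compl ?_
  rw [hφ.map_sub, h₁, sub_zero, hφ.map_one.1]

theorem IsStarJordanDer.sub_innerDer_peirce {A : Type*} [NonAssocRing A] [StarRing A]
    [IsAddTorsionFree A] {e : A} {Φ : A → A} (hΦ : IsStarJordanDer Φ) (he : IsFaithfulIdem e)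
    {φ : A → A}
    (hφ : ∀ a, φ a = Φ a - innerDer (e * (Φ e * (1 - e)) + (1 - e) * (Φ e * e)) e a) :
    IsStarJordanDer φ ∧ φ e = 0 ∧ φ (1 - e) = 0 := by
  obtain ⟨p, q, r, hp, hq, hr, h, hps, hrs⟩ := hΦ.peirce_idem he
  have hy : e * (Φ e * (1 - e)) + (1 - e) * (Φ e * e) = q + r := by
    simp only [h, mul_sub, sub_mul, mul_add, add_mul, mul_one, one_mul, hp.left, hq.left, hr.left,
      hp.right, hq.right, hr.right, one_smul, zero_smul, mul_zero]
    abel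
  have hqs : star q = r := by rw [← hrs, star_star]
  obtain rfl : φ = fun a => Φ a - innerDer (q + r) e a := funext fun a => by rw [hφ, hy]
  have hder := hΦ.sub_innerDer he.alt_left he.alt_right (y := q + r) (z := e)
    (by rw [star_add, hqs, hrs, add_comm]) he.star_eq
  have hp' : Φ e - innerDer (q + r) e e = p := by
    simp only [innerDer, he.idem, h, mul_add, add_mul, hq.left, hr.left, hq.right, hr.right,
      one_smul, zero_smul, add_zero, zero_add]
    abel
  have h₁ : Φ e - innerDer (q + r) e e = 0 :=
    hder.idem_eq_zero he (by rwa [hp']) (by rw [hp', hps])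
  exact ⟨hder, h₁, hder.map_compl_eq_zero he h₁⟩

theorem IsStarJordanDer.leibniz_peirce {A : Type*} [NonAssocRing A] [StarRing A]
    [IsAddTorsionFree A] {e : A} {φ : A → A} (hφ : IsStarJordanDer φ) (he : IsFaithfulIdem e)
    (h₁ : φ e = 0) (h₂ : φ (1 - e) = 0) {aii bii aij bij bji bjj : A}
    (haii : PeirceWeight e 1 1 aii) (hbii : PeirceWeight e 1 1 bii)
    (haij : PeirceWeight e 1 0 aij) (hbij : PeirceWeight e 1 0 bij)
    (hbji : PeirceWeight e 0 1 bji) (hbjj : PeirceWeight e 0 0 bjj) :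
    φ (aii * bii) = φ aii * bii + aii * φ bii ∧
    φ (aii * bij) = φ aii * bij + aii * φ bij ∧
    φ (aij * bji) = φ aij * bji + aij * φ bji ∧
    φ (aij * bjj) = φ aij * bjj + aij * φ bjj ∧
    φ (aij * bij) = φ aij * bij + aij * φ bij :=
  ⟨hφ.leibniz_corner he h₁ h₂ haii hbii, hφ.leibniz_corner_upper he h₁ h₂ haii hbij,
    hφ.leibniz_upper_lower he h₁ h₂ haij hbji, hφ.leibniz_upper_corner he h₁ h₂ haij hbjj,
    hφ.leibniz_upper_upper he h₁ h₂ haij hbij⟩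

theorem inPeirce.peirceWeight {A : Type*} [NonAssocRing A] {e x : A} {i j : Fin 2}
    (h : inPeirce e i j x) : PeirceWeight e (1 - i.1) (1 - j.1) x := by
  obtain ⟨hl, hr⟩ := h
  constructor
  · fin_cases i <;> simp_all [peirceIdem, sub_mul]
  · fin_cases j <;> simp_all [peirceIdem, mul_sub]

theorem stmt_17 {A : Type*} [NonAssocRing A] [Module ℂ A]
    [SMulCommClass ℂ A A] [IsScalarTower ℂ A A] [StarRing A]
    (halt₁ : ∀ a b : A, a * a * b = a * (a * b))
    (halt₂ : ∀ a b : A, b * a * a = b * (a * a))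
    (e : A) (heStar : star e = e) (heIdem : e * e = e) (he0 : e ≠ 0) (he1 : e ≠ 1)
    (hsp : ∀ x : A, (∀ r : A, x * r * e = 0) → x = 0)
    (hcl : ∀ x : A, (∀ r : A, x * r * (1 - e) = 0) → x = 0)
    (n : ℕ) (hn : 2 ≤ n) (Φ : A → A)
    (hΦ : ∀ x y : A,
      Φ (leftStarJordan (List.ofFn (lastTwoFamily n x y))) =
        ∑ k : Fin n, leftStarJordan (List.ofFn
          (Function.update (lastTwoFamily n x y) k (Φ (lastTwoFamily n x y k))))) :
    ∀ φ : A → A,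
      (∀ a : A, φ a = Φ a -
        innerDer (e * (Φ e * (1 - e)) + (1 - e) * (Φ e * e)) e a) →
      ∀ i j : Fin 2, i ≠ j →
      ∀ aii bii aij bij bji bjj : A,
        inPeirce e i i aii → inPeirce e i i bii →
        inPeirce e i j aij → inPeirce e i j bij →
        inPeirce e j i bji → inPeirce e j j bjj →
        φ (aii * bii) = φ aii * bii + aii * φ bii ∧
        φ (aii * bij) = φ aii * bij + aii * φ bij ∧
        φ (aij * bji) = φ aij * bji + aij * φ bji ∧
        φ (aij * bjj) = φ aij * bjj + aij * φ bjj ∧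
        φ (aij * bij) = φ aij * bij + aij * φ bij := by
  let _ : Module ℚ A := Module.compHom A (algebraMap ℚ ℂ)
  have : IsAddTorsionFree A := .of_module_rat A
  have he : IsFaithfulIdem e := ⟨halt₁, halt₂, heStar, heIdem, hsp, hcl⟩
  obtain ⟨N, α, β, hN, hS⟩ := exists_isScaledStarJordanDer hn hΦ
  intro φ hφ i j hij aii bii aij bij bji bjj haii hbii haij hbij hbji hbjj
  obtain ⟨hder, h₁, h₂⟩ := (hS.isStarJordanDer he hN).sub_innerDer_peirce he hφ
  have haii := haii.peirceWeight
  have hbii := hbii.peirceWeight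
  have haij := haij.peirceWeight
  have hbij := hbij.peirceWeight
  have hbji := hbji.peirceWeight
  have hbjj := hbjj.peirceWeight
  obtain ⟨rfl, rfl⟩ | ⟨rfl, rfl⟩ : i = 0 ∧ j = 1 ∨ i = 1 ∧ j = 0 := by omega
  · exact hder.leibniz_peirce he h₁ h₂ haii hbii haij hbij hbji hbjj
  · exact hder.leibniz_peirce he.compl h₂ (by rwa [sub_sub_cancel]) haii.compl hbii.compl
      haij.compl hbij.compl hbji.compl hbjj.compl
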